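/- arXiv:2507.14508 — 2 statements merged into one kernel-verified Lean document; each statement's English description precedes it below -/
import Mathlib

section
/- Let X be a complex normed space, D ⊆ X a domain (nonempty open connected set) with nonempty boundary, and f : D → ℂ a bounded analytic function. Then for every x ∈ D and every 0 < r < dist(x, ∂D), setting M = sup_{y ∈ B(x, r)} |f(y)|, one has r·M·‖df(x)‖ ≤ M² − |f(x)|²; in particular ‖df(x)‖ ≤ (2/r)·sup_{y ∈ B(x, r)} ||f(y)| − |f(x)||, i.e. f is 1-regular with constant K = 2 with respect to the weight dist(·, ∂D) and the set A = {0}. -/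
open Metric ComplexConjugate in
/-- **Schwarz–Pick estimate at the centre of a ball.** -/
theorem schwarzPick_norm_fderiv_center {X : Type*} [NormedAddCommGroup X] [NormedSpace ℂ X]
    {f : X → ℂ} {f' : X →L[ℂ] ℂ} {x : X} {r M : ℝ} (hr : 0 < r)
    (hd : DifferentiableOn ℂ f (ball x r)) (hf : HasFDerivAt f f' x)
    (hM : ∀ y ∈ ball x r, ‖f y‖ < M) :
    r * M * ‖f'‖ ≤ M ^ 2 - ‖f x‖ ^ 2 := by
  have hx := hM x (mem_ball_self hr)
  have hM0 : 0 < M := (norm_nonneg _).trans_lt hx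
  have hpos : 0 < M ^ 2 - ‖f x‖ ^ 2 := by nlinarith [norm_nonneg (f x)]
  have hden : ∀ y ∈ ball x r, (M : ℂ) ^ 2 - conj (f x) * f y ≠ 0 := by
    intro y hy h
    have h1 : ‖(M : ℂ) ^ 2‖ = ‖conj (f x) * f y‖ := by rw [sub_eq_zero.mp h]
    rw [norm_pow, norm_mul, RCLike.norm_conj, Complex.norm_real, Real.norm_of_nonneg hM0.le] at h1
    nlinarith [hM y hy, norm_nonneg (f x), norm_nonneg (f y)]
  set m : ℂ → ℂ := fun w ↦ M ^ 2 * (w - f x) / (M ^ 2 - conj (f x) * w)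
  have hm : ∀ w, (M : ℂ) ^ 2 - conj (f x) * w ≠ 0 → DifferentiableAt ℂ m w := by
    intro w hw
    fun_prop (disch := exact hw)
  set g : X → ℂ := m ∘ f with hg
  have hgd : DifferentiableOn ℂ g (ball x r) := fun y hy ↦
    (hm _ (hden y hy)).comp_differentiableWithinAt y (hd y hy)
  have hmaps : Set.MapsTo g (ball x r) (closedBall (g x) M) := by
    intro y hy
    have hgx : g x = 0 := by simp [hg, m]
    have hd0 := norm_pos_iff.mpr (hden y hy)
    rw [hgx, mem_closedBall_zero_iff]
    simp only [hg, m, Function.comp_apply]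
    rw [norm_div, norm_mul, norm_pow, Complex.norm_real, Real.norm_of_nonneg hM0.le,
      div_le_iff₀ hd0]
    have key : M * ‖f y - f x‖ < ‖(M : ℂ) ^ 2 - conj (f x) * f y‖ := by
      refine lt_of_pow_lt_pow_left₀ 2 hd0.le ?_
      have hy2 : 0 < M ^ 2 - ‖f y‖ ^ 2 := by nlinarith [hM y hy, norm_nonneg (f y)]
      have := mul_pos hpos hy2
      rw [mul_pow]
      simp only [← Complex.normSq_eq_norm_sq, Complex.normSq_apply] at this ⊢
      simp [pow_two] at this ⊢
      nlinarith
    nlinarith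
  have hxden : (M : ℂ) ^ 2 - conj (f x) * f x = ((M ^ 2 - ‖f x‖ ^ 2 : ℝ) : ℂ) := by
    rw [Complex.conj_mul']; push_cast; rfl
  have hg' : HasFDerivAt g (((M ^ 2 / (M ^ 2 - ‖f x‖ ^ 2) : ℝ) : ℂ) • f') x := by
    have hne := hden x (mem_ball_self hr)
    have hnum : HasDerivAt (fun w : ℂ ↦ (M : ℂ) ^ 2 * (w - f x)) (M ^ 2) (f x) := by
      simpa using ((hasDerivAt_id (f x)).sub_const (f x)).const_mul ((M : ℂ) ^ 2)
    have hdn : HasDerivAt (fun w : ℂ ↦ (M : ℂ) ^ 2 - conj (f x) * w) (-conj (f x)) (f x) := by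
      simpa using ((hasDerivAt_id (f x)).const_mul (conj (f x))).const_sub ((M : ℂ) ^ 2)
    have hmx := (hnum.fun_div hdn hne).comp_hasFDerivAt x hf
    rw [sub_self, mul_zero, zero_mul, sub_zero, pow_two (_ - _), mul_div_mul_right _ _ hne,
      hxden] at hmx
    rwa [Complex.ofReal_div, Complex.ofReal_pow]
  have h := Complex.norm_fderiv_le_div_of_mapsTo_ball hgd hmaps hr
  rw [hg'.fderiv, norm_smul, Complex.norm_real, Real.norm_of_nonneg (by positivity),
    div_mul_eq_mul_div, div_le_div_iff₀ hpos hr] at h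
  nlinarith

open Metric in
/-- A ball around a point of an open set whose radius does not exceed the distance to the
frontier is contained in the set. -/
theorem IsOpen.ball_subset_of_le_infDist_frontier {X : Type*} [NormedAddCommGroup X]
    [NormedSpace ℝ X] {D : Set X} (hD : IsOpen D) {x : X} (hx : x ∈ D) {r : ℝ}
    (hr : r ≤ infDist x (frontier D)) : ball x r ⊆ D := by
  rcases le_or_gt r 0 with h0 | h0
  · simp [ball_eq_empty.mpr h0]
  have hdisj : Disjoint (ball x r) (frontier D) :=
    (disjoint_ball_infDist (x := x)).mono_left (ball_subset_ball hr)
  refine (convex_ball x r).isPreconnected.subset_of_closure_inter_subset hD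
    ⟨x, mem_ball_self h0, hx⟩ fun y ⟨hyc, hyb⟩ ↦ ?_
  by_contra hyD
  exact Set.disjoint_left.mp hdisj hyb ⟨hyc, by rwa [hD.interior_eq]⟩


/-- A bounded analytic function on a domain with nonempty boundary in a complex normed space
satisfies, for `0 < r < dist(x, ∂D)` and `M = sup_{y ∈ B(x,r)} |f(y)|`, the Schwarz–Pick type
estimate `r·M·‖df(x)‖ ≤ M² - |f(x)|²`, and consequently is `1`-regular with constant
`K = 2`. -/
theorem stmt14 {X : Type*} [NormedAddCommGroup X] [NormedSpace ℂ X]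
    (D : Set X) (hD : IsOpen D) (hDconn : IsConnected D)
    (hfr : (frontier D).Nonempty)
    (f : X → ℂ) (df : X → X →L[ℂ] ℂ)
    (hf : ∀ z ∈ D, HasFDerivAt f (df z) z)
    (B : ℝ) (hB : ∀ z ∈ D, ‖f z‖ ≤ B)
    (x : X) (hx : x ∈ D) (r : ℝ) (hr : 0 < r)
    (hrd : r < Metric.infDist x (frontier D)) :
    r * sSup ((fun y => ‖f y‖) '' Metric.ball x r) * ‖df x‖
        ≤ (sSup ((fun y => ‖f y‖) '' Metric.ball x r)) ^ 2 - ‖f x‖ ^ 2 ∧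
    ‖df x‖ ≤ (2 / r) * sSup ((fun y => |‖f y‖ - ‖f x‖|) '' Metric.ball x r) := by
  let : NormedSpace ℝ X := NormedSpace.restrictScalars ℝ ℂ X
  have hsub := hD.ball_subset_of_le_infDist_frontier hx hrd.le
  have hxr := Metric.mem_ball_self (x := x) hr
  have hbdd : BddAbove ((fun y => ‖f y‖) '' Metric.ball x r) :=
    ⟨B, Set.forall_mem_image.mpr fun y hy ↦ hB y (hsub hy)⟩
  have hbdd' : BddAbove ((fun y => |‖f y‖ - ‖f x‖|) '' Metric.ball x r) := by
    refine ⟨B + B, Set.forall_mem_image.mpr fun y hy ↦ ?_⟩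
    have h1 := hB y (hsub hy)
    have h2 := hB x hx
    rw [abs_le]
    constructor <;> linarith [norm_nonneg (f x), norm_nonneg (f y)]
  set M := sSup ((fun y => ‖f y‖) '' Metric.ball x r)
  set S := sSup ((fun y => |‖f y‖ - ‖f x‖|) '' Metric.ball x r)
  have hle : ∀ y ∈ Metric.ball x r, ‖f y‖ ≤ M := fun y hy ↦ le_csSup hbdd ⟨y, hy, rfl⟩
  have hpick : ∀ M' > M, r * M' * ‖df x‖ ≤ M' ^ 2 - ‖f x‖ ^ 2 := fun M' hM' ↦
    schwarzPick_norm_fderiv_center hr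
      (fun y hy ↦ (hf y (hsub hy)).differentiableAt.differentiableWithinAt) (hf x hx)
      fun y hy ↦ (hle y hy).trans_lt hM'
  refine ⟨?_, ?_⟩
  · exact ContinuousWithinAt.closure_le (s := Set.Ioi M)
      (f := fun M' ↦ r * M' * ‖df x‖) (g := fun M' ↦ M' ^ 2 - ‖f x‖ ^ 2)
      (by simp) (by fun_prop) (by fun_prop) hpick
  · have hMS : M ≤ ‖f x‖ + S := by
      refine csSup_le ⟨_, x, hxr, rfl⟩ (Set.forall_mem_image.mpr fun y hy ↦ ?_)
      have h1 : |‖f y‖ - ‖f x‖| ≤ S := le_csSup hbdd' ⟨y, hy, rfl⟩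
      linarith [le_abs_self (‖f y‖ - ‖f x‖)]
    rw [div_mul_eq_mul_div, le_div_iff₀ hr]
    refine le_of_forall_pos_le_add fun ε hε ↦ ?_
    have hx0 := norm_nonneg (f x)
    have hxM := hle x hxr
    have h := hpick (M + ε / 2) (by linarith)
    have hpos : 0 < M + ε / 2 := by linarith
    refine le_of_mul_le_mul_left ?_ hpos
    nlinarith
end

section
/- Let α ∈ (0, 1), let D be a c-uniform domain in a complex normed space X, let Y be a complex inner product space, and let f : D → Y be a bounded analytic mapping. Suppose there is C ≥ 0 such that |‖f(y)‖² − ‖f(x)‖²| ≤ C·‖x − y‖^α whenever x ∈ D and ‖y − x‖ < dist(x, ∂D)/2. Then ‖f(z) − f(w)‖ ≤ (8c/α)·√C·‖z − w‖^{α/2} for all z, w ∈ D. -/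
open scoped Topology ComplexConjugate InnerProductSpace in
/-- A two-term Parseval inequality: bounding `‖g‖²` by `M` on the circle of radius `r` bounds
`‖g 0‖² + r² ‖g' 0‖²` by `M`. -/
theorem norm_sq_add_sq_mul_norm_deriv_sq_le {Y : Type*} [NormedAddCommGroup Y]
    [InnerProductSpace ℂ Y] {g : ℂ → Y} {R r M : ℝ} (hr : 0 < r) (hrR : r < R)
    (hg : DifferentiableOn ℂ g (Metric.ball 0 R))
    (hM : ∀ ζ : ℂ, ‖ζ‖ = r → ‖g ζ‖ ^ 2 ≤ M) :
    ‖g 0‖ ^ 2 + r ^ 2 * ‖deriv g 0‖ ^ 2 ≤ M := by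
  have hmem : Metric.ball (0 : ℂ) R ∈ 𝓝 0 := Metric.ball_mem_nhds _ (hr.trans hrR)
  set a₀ := g 0 with ha₀
  set a₁ := deriv g 0 with ha₁
  set S : ℝ := ‖a₀‖ ^ 2 + r ^ 2 * ‖a₁‖ ^ 2 with hS
  let φ : ℂ → ℂ := fun ζ => ⟪a₁, g ζ⟫_ℂ
  have hφ : DifferentiableOn ℂ φ (Metric.ball 0 R) :=
    (innerSL ℂ a₁).differentiable.comp_differentiableOn hg
  have hφ' : deriv φ 0 = ⟪a₁, a₁⟫_ℂ :=
    ((innerSL ℂ a₁).hasFDerivAt.comp_hasDerivAt (0 : ℂ)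
      (hg.differentiableAt hmem).hasDerivAt).deriv
  let H : ℂ → ℂ := fun ζ => 2 * ⟪a₀, g ζ⟫_ℂ + 2 * (r : ℂ) ^ 2 * dslope φ 0 ζ - S
  have hH : DifferentiableOn ℂ H (Metric.ball 0 R) :=
    ((((innerSL ℂ a₀).differentiable.comp_differentiableOn hg).const_mul 2).add
      (((Complex.differentiableOn_dslope hmem).2 hφ).const_mul _)).sub_const _
  have hH0 : (H 0).re = S := by
    simp only [H, dslope_same, hφ', ← ha₀, inner_self_eq_norm_sq_to_K, Complex.coe_algebraMap]
    norm_cast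
    rw [hS]; ring
  have hcirc : ∀ ζ : ℂ, ‖ζ‖ = r → (H ζ).re ≤ M := by
    intro ζ hζ
    have hζ0 : ζ ≠ 0 := by rintro rfl; simp at hζ; exact hr.ne hζ
    have hrr : (r : ℂ) ^ 2 = conj ζ * ζ := by
      rw [mul_comm, Complex.mul_conj, Complex.normSq_eq_norm_sq, hζ]; norm_cast
    have hd : (r : ℂ) ^ 2 * dslope φ 0 ζ = ⟪ζ • a₁, g ζ - a₀⟫_ℂ := by
      rw [dslope_of_ne _ hζ0, slope_def_field, hrr, inner_smul_left, inner_sub_right]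
      simp only [φ, sub_zero]
      field_simp
      rfl
    have hp : (H ζ).re = ‖g ζ‖ ^ 2 - ‖g ζ - (a₀ + ζ • a₁)‖ ^ 2 := by
      have e : H ζ = 2 * (⟪a₀, g ζ⟫_ℂ + ⟪ζ • a₁, g ζ - a₀⟫_ℂ) - S := by
        simp only [H]; rw [mul_assoc, hd]; ring
      have e1 := @norm_sub_sq ℂ _ _ _ _ (g ζ) (a₀ + ζ • a₁)
      have e2 := @norm_add_sq ℂ _ _ _ _ a₀ (ζ • a₁)
      rw [norm_smul, hζ, mul_pow] at e2
      rw [e1, e2, e, inner_re_symm, inner_re_symm (𝕜 := ℂ) a₀]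
      simp only [inner_add_left, inner_sub_right, RCLike.re_to_complex, Complex.sub_re,
        Complex.add_re, Complex.ofReal_re, Complex.re_ofNat, Complex.im_ofNat, Complex.mul_re]
      rw [hS]; ring
    rw [hp]
    have := hM ζ hζ
    nlinarith [sq_nonneg ‖g ζ - (a₀ + ζ • a₁)‖]
  have hmax := Complex.norm_le_of_forall_mem_frontier_norm_le (F := ℂ)
    (f := fun ζ => Complex.exp (H ζ)) (C := Real.exp M) (z := 0)
    (Metric.isBounded_ball (x := (0 : ℂ)) (r := r))
    ((hH.cexp.mono (Metric.closedBall_subset_ball hrR)).diffContOnCl_ball subset_rfl)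
    (fun ζ hζ => by
      rw [Complex.norm_exp, Real.exp_le_exp]
      exact hcirc ζ (by simpa using Metric.frontier_ball_subset_sphere hζ))
    (subset_closure (Metric.mem_ball_self hr))
  rwa [Complex.norm_exp, Real.exp_le_exp, hH0] at hmax

open scoped Topology in
theorem norm_fderiv_le_of_norm_sq_le {X Y : Type*} [NormedAddCommGroup X] [NormedSpace ℂ X]
    [NormedAddCommGroup Y] [InnerProductSpace ℂ Y] {f : X → Y} {x : X} {ρ C α : ℝ} (hρ : 0 < ρ)
    (hC : 0 ≤ C) (hf : DifferentiableOn ℂ f (Metric.ball x ρ))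
    (h : ∀ y ∈ Metric.ball x ρ, ‖f y‖ ^ 2 ≤ ‖f x‖ ^ 2 + C * ‖x - y‖ ^ α) :
    ‖fderiv ℂ f x‖ ≤ √C * ρ ^ (α / 2 - 1) := by
  refine ContinuousLinearMap.opNorm_le_of_unit_norm (by positivity) fun v hv => ?_
  have hdist (ζ : ℂ) : dist (x + ζ • v) x = ‖ζ‖ := by simp [norm_smul, hv]
  let g : ℂ → Y := fun ζ => f (x + ζ • v)
  have hline (ζ : ℂ) : HasDerivAt (fun ζ : ℂ => x + ζ • v) v ζ := by
    simpa using ((hasDerivAt_id ζ).smul_const v).const_add x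
  have hg : DifferentiableOn ℂ g (Metric.ball 0 ρ) :=
    hf.comp (fun ζ _ => (hline ζ).differentiableAt.differentiableWithinAt)
      (fun ζ hζ => by simpa [hdist] using hζ)
  have hg' : deriv g 0 = fderiv ℂ f x v := by
    have h0 : HasFDerivAt f (fderiv ℂ f x) (x + (0 : ℂ) • v) := by
      simpa using (hf.differentiableAt (Metric.ball_mem_nhds x hρ)).hasFDerivAt
    exact (h0.comp_hasDerivAt (0 : ℂ) (hline 0)).deriv
  have key : ∀ r ∈ Set.Ioo 0 ρ, r ^ 2 * ‖fderiv ℂ f x v‖ ^ 2 ≤ C * r ^ α := by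
    rintro r ⟨hr, hrρ⟩
    have := norm_sq_add_sq_mul_norm_deriv_sq_le (M := ‖f x‖ ^ 2 + C * r ^ α) hr hrρ hg
      fun ζ hζ => by
        have := h (x + ζ • v) (by rwa [Metric.mem_ball, hdist, hζ])
        rwa [← dist_eq_norm, dist_comm, hdist, hζ] at this
    rw [hg', show g 0 = f x by simp [g]] at this
    linarith
  have hlim : ρ ^ 2 * ‖fderiv ℂ f x v‖ ^ 2 ≤ C * ρ ^ α := by
    have h1 : ContinuousAt (fun r : ℝ => r ^ 2 * ‖fderiv ℂ f x v‖ ^ 2) ρ := by fun_prop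
    have h2 : ContinuousAt (fun r : ℝ => C * r ^ α) ρ :=
      continuousAt_const.mul (continuousAt_id.rpow_const (Or.inl hρ.ne'))
    refine le_of_tendsto_of_tendsto (h1.tendsto.mono_left nhdsWithin_le_nhds)
      (h2.tendsto.mono_left nhdsWithin_le_nhds) (b := 𝓝[<] ρ) ?_
    filter_upwards [Ioo_mem_nhdsLT hρ] with r hr using key r hr
  have hρα : (ρ ^ (α / 2 - 1) * ρ) ^ 2 = ρ ^ α := by
    rw [← Real.rpow_add_one hρ.ne', ← Real.rpow_natCast, ← Real.rpow_mul hρ.le]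
    congr 1; push_cast; ring
  refine le_of_mul_le_mul_left ?_ hρ
  refine (pow_le_pow_iff_left₀ (by positivity) (by positivity) two_ne_zero).1 ?_
  rw [mul_pow]
  refine hlim.trans_eq ?_
  rw [← hρα]
  nth_rewrite 1 [← Real.sq_sqrt hC]
  ring

theorem Metric.ball_infDist_frontier_subset {X : Type*} [NormedAddCommGroup X] [NormedSpace ℝ X]
    {D : Set X} (hD : IsOpen D) {x : X} (hx : x ∈ D) :
    Metric.ball x (Metric.infDist x (frontier D)) ⊆ D := by
  rcases (Metric.infDist_nonneg (x := x) (s := frontier D)).eq_or_lt with h | h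
  · simp [← h]
  refine (convex_ball x _).isPreconnected.subset_of_closure_inter_subset hD
    ⟨x, Metric.mem_ball_self h, hx⟩ fun y ⟨hy, hyb⟩ => ?_
  by_contra hyD
  exact Metric.ball_infDist_subset_compl hyb ⟨hy, by rwa [hD.interior_eq]⟩

open scoped Topology in
/-- A mean value inequality along a 1-Lipschitz path, with a derivative bound that may blow up
at the starting point. -/
theorem norm_sub_le_of_norm_fderiv_le_rpow {X Y : Type*} [NormedAddCommGroup X] [NormedSpace ℂ X]
    [NormedAddCommGroup Y] [NormedSpace ℂ Y] {D : Set X} (hD : IsOpen D) {f : X → Y}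
    (hf : DifferentiableOn ℂ f D) {γ : ℝ → X} {l K β : ℝ} (hl : 0 ≤ l) (hK : 0 ≤ K) (hβ : 0 < β)
    (hγD : Set.MapsTo γ (Set.Icc 0 l) D) (hγ : LipschitzOnWith 1 γ (Set.Icc 0 l))
    (hbound : ∀ s ∈ Set.Ioc 0 l, ‖fderiv ℂ f (γ s)‖ ≤ K * s ^ (β - 1)) :
    ‖f (γ l) - f (γ 0)‖ ≤ K / β * l ^ β := by
  rcases hl.eq_or_lt with rfl | hl
  · simp [Real.zero_rpow hβ.ne']
  have hcont : ContinuousOn (f ∘ γ) (Set.Icc 0 l) := hf.continuousOn.comp hγ.continuousOn hγD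
  have main : ∀ a ∈ Set.Ioo 0 l, ‖f (γ l) - f (γ a)‖ ≤ K / β * l ^ β := by
    rintro a ⟨ha, hal⟩
    have hsub : Set.Icc a l ⊆ Set.Icc 0 l := Set.Icc_subset_Icc_left ha.le
    have hderiv (x : ℝ) (hx : 0 < x) :
        HasDerivAt (fun s : ℝ => K / β * s ^ β) (K * x ^ (β - 1)) x := by
      refine ((Real.hasDerivAt_rpow_const (p := β) (Or.inl hx.ne')).const_mul (K / β)).congr_deriv ?_
      rw [← mul_assoc, div_mul_cancel₀ K hβ.ne']
    refine image_le_of_liminf_slope_right_le_deriv_boundary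
      (f := fun s => ‖f (γ s) - f (γ a)‖) (B := fun s => K / β * s ^ β)
      (B' := fun s => K * s ^ (β - 1)) (a := a) (b := l)
      ((hcont.mono hsub).sub continuousOn_const).norm
      (by simp only [sub_self, norm_zero]; positivity)
      (fun x hx => (hderiv x (ha.trans_le hx.1)).continuousAt.continuousWithinAt)
      (fun x hx => (hderiv x (ha.trans_le hx.1)).hasDerivWithinAt)
      (fun x hx r hr => Filter.Eventually.frequently ?_) (Set.right_mem_Icc.2 hal.le)
    have hx0 : 0 < x := ha.trans_le hx.1
    have hxI : x ∈ Set.Icc 0 l := ⟨hx0.le, hx.2.le⟩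
    obtain ⟨q, hq, hqr⟩ := exists_between hr
    have hfd := (hf.differentiableAt (hD.mem_nhds (hγD hxI))).hasFDerivAt
    have hev : ∀ᶠ y in 𝓝 (γ x), ‖f y - f (γ x)‖ ≤ q * ‖y - γ x‖ := by
      have h1 := hfd.isLittleO.def (sub_pos.2 hq)
      filter_upwards [h1] with y hy
      calc ‖f y - f (γ x)‖
          = ‖(f y - f (γ x) - fderiv ℂ f (γ x) (y - γ x)) + fderiv ℂ f (γ x) (y - γ x)‖ := by
            rw [sub_add_cancel]
        _ ≤ (q - K * x ^ (β - 1)) * ‖y - γ x‖ + K * x ^ (β - 1) * ‖y - γ x‖ :=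
            (norm_add_le _ _).trans (add_le_add hy
              ((fderiv ℂ f (γ x)).le_of_opNorm_le (hbound x ⟨hx0, hx.2.le⟩) _))
        _ = q * ‖y - γ x‖ := by ring
    have hIcc : Set.Icc 0 l ∈ 𝓝[>] x :=
      Filter.mem_of_superset (Ioo_mem_nhdsGT hx.2) fun z hz => ⟨(hx0.trans hz.1).le, hz.2.le⟩
    have htend : Filter.Tendsto γ (𝓝[>] x) (𝓝 (γ x)) :=
      (hγ.continuousOn x hxI).tendsto.mono_left (nhdsWithin_le_of_mem hIcc)
    filter_upwards [htend.eventually hev, hIcc, self_mem_nhdsWithin] with z hz hzI hxz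
    have hxz' : 0 < z - x := sub_pos.2 hxz
    refine lt_of_le_of_lt ?_ hqr
    rw [slope_def_field, div_le_iff₀ hxz']
    have hq0 : 0 ≤ q := le_trans (by positivity) hq.le
    have hlip : ‖γ z - γ x‖ ≤ z - x := by
      have := hγ.dist_le_mul z hzI x hxI
      rwa [dist_eq_norm, Real.dist_eq, abs_of_pos hxz', NNReal.coe_one, one_mul] at this
    calc ‖f (γ z) - f (γ a)‖ - ‖f (γ x) - f (γ a)‖
        ≤ ‖(f (γ z) - f (γ a)) - (f (γ x) - f (γ a))‖ := norm_sub_norm_le _ _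
      _ = ‖f (γ z) - f (γ x)‖ := by rw [sub_sub_sub_cancel_right]
      _ ≤ q * (z - x) := hz.trans (by gcongr)
  have hlim : Filter.Tendsto (fun a => ‖f (γ l) - f (γ a)‖) (𝓝[>] 0) (𝓝 ‖f (γ l) - f (γ 0)‖) :=
    (tendsto_const_nhds.sub ((hcont 0 (Set.left_mem_Icc.2 hl.le)).tendsto.mono_left
      (nhdsWithin_le_of_mem (Icc_mem_nhdsGT hl)))).norm
  refine le_of_tendsto hlim ?_
  filter_upwards [Ioo_mem_nhdsGT hl] with a ha using main a ha

/-- Dyakonov type theorem on uniform domains (inner product range): if `f` is a bounded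
analytic mapping on a `c`-uniform domain `D` in a complex normed space with values in a
complex inner product space and `‖f‖²` is locally `α`-Hölder with constant `C` (on balls
`B(x, dist(x,∂D)/2)`), then `f` is globally `(α/2)`-Hölder on `D` with constant
`(8c/α)·√C`. -/
theorem stmt16 {X Y : Type*} [NormedAddCommGroup X] [NormedSpace ℂ X]
    [NormedAddCommGroup Y] [InnerProductSpace ℂ Y]
    (α : ℝ) (hα : α ∈ Set.Ioo (0 : ℝ) 1) (c : ℝ) (hc : 0 < c)
    (D : Set X) (hD : IsOpen D) (hDconn : IsConnected D)
    (hfr : (frontier D).Nonempty)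
    (huniform : ∀ x ∈ D, ∀ y ∈ D, ∃ L : ℝ, 0 ≤ L ∧ ∃ γ : ℝ → X,
      (∀ s ∈ Set.Icc (0 : ℝ) L, γ s ∈ D) ∧
      Set.InjOn γ (Set.Icc (0 : ℝ) L) ∧
      (∀ s t : ℝ, 0 ≤ s → s ≤ t → t ≤ L →
        eVariationOn γ (Set.Icc s t) = ENNReal.ofReal (t - s)) ∧
      γ 0 = x ∧ γ L = y ∧ L ≤ c * ‖x - y‖ ∧
      ∀ s ∈ Set.Icc (0 : ℝ) L,
        min s (L - s) ≤ c * Metric.infDist (γ s) (frontier D))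
    (f : X → Y) (hf : DifferentiableOn ℂ f D)
    (B : ℝ) (hB : ∀ z ∈ D, ‖f z‖ ≤ B)
    (C : ℝ) (hC : 0 ≤ C)
    (hloc : ∀ x ∈ D, ∀ y : X, ‖y - x‖ < Metric.infDist x (frontier D) / 2 →
      |‖f y‖ ^ 2 - ‖f x‖ ^ 2| ≤ C * ‖x - y‖ ^ α) :
    ∀ z ∈ D, ∀ w ∈ D,
      ‖f z - f w‖ ≤ (8 * c / α) * Real.sqrt C * ‖z - w‖ ^ (α / 2) := by
  obtain ⟨hα0, hα1⟩ := hα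
  set K : ℝ := √C * (2 * c) ^ (1 - α / 2) with hKdef
  have hK : 0 ≤ K := by positivity
  have hderiv : ∀ x ∈ D, ∀ s : ℝ, 0 < s → s ≤ c * Metric.infDist x (frontier D) →
      ‖fderiv ℂ f x‖ ≤ K * s ^ (α / 2 - 1) := by
    intro x hx s hs hsd
    set d := Metric.infDist x (frontier D) with hd
    have hd0 : 0 < d := pos_of_mul_pos_right (hs.trans_le hsd) hc.le
    have hball : Metric.ball x (d / 2) ⊆ D :=
      (Metric.ball_subset_ball (half_le_self hd0.le)).trans
        (Metric.ball_infDist_frontier_subset (X := X) hD hx)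
    refine (norm_fderiv_le_of_norm_sq_le (α := α) (half_pos hd0) hC (hf.mono hball)
      fun y hy => ?_).trans ?_
    · have := (abs_le.1 (hloc x hx y (by rwa [← dist_eq_norm]))).2
      linarith
    · rw [hKdef, mul_assoc]
      refine mul_le_mul_of_nonneg_left ?_ (Real.sqrt_nonneg C)
      have h1 : (d / 2) ^ (α / 2 - 1) ≤ (s / (2 * c)) ^ (α / 2 - 1) := by
        refine Real.rpow_le_rpow_of_nonpos (by positivity) ?_ (by linarith)
        rw [div_le_div_iff₀ (by positivity) two_pos]
        linarith
      refine h1.trans_eq ?_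
      rw [Real.div_rpow hs.le (by positivity), div_eq_mul_inv, ← Real.rpow_neg (by positivity),
        neg_sub, mul_comm]
  intro z hz w hw
  obtain ⟨L, hL, γ, hγD, -, hγlen, rfl, rfl, hLc, hγd⟩ := huniform z hz w hw
  have hlip : LipschitzOnWith 1 γ (Set.Icc 0 L) := by
    refine LipschitzOnWith.of_dist_le_mul fun s hs t ht => ?_
    wlog hst : s ≤ t generalizing s t
    · rw [dist_comm, dist_comm s]
      exact this t ht s hs (le_of_not_ge hst)
    have := eVariationOn.edist_le γ (Set.left_mem_Icc.2 hst) (Set.right_mem_Icc.2 hst)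
    rw [hγlen s t hs.1 hst ht.2, edist_dist, ENNReal.ofReal_le_ofReal_iff (sub_nonneg.2 hst)] at this
    rwa [NNReal.coe_one, one_mul, dist_comm s, Real.dist_eq, abs_of_nonneg (sub_nonneg.2 hst)]
  have hL2 : 0 ≤ L / 2 := by positivity
  have hsub : Set.Icc 0 (L / 2) ⊆ Set.Icc 0 L := Set.Icc_subset_Icc_right (half_le_self hL)
  have hmaps : Set.MapsTo (fun s => L - s) (Set.Icc 0 (L / 2)) (Set.Icc 0 L) :=
    fun s hs => ⟨by linarith [hs.2], by linarith [hs.1]⟩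
  have hfst := norm_sub_le_of_norm_fderiv_le_rpow hD hf hL2 hK (half_pos hα0)
    (fun s hs => hγD s (hsub hs)) (hlip.mono hsub) fun s hs => by
      have hsI := hsub ⟨hs.1.le, hs.2⟩
      have := hγd s hsI
      rw [min_eq_left (by linarith [hs.2])] at this
      exact hderiv _ (hγD s hsI) s hs.1 this
  have hsnd := norm_sub_le_of_norm_fderiv_le_rpow (γ := fun s => γ (L - s)) hD hf
    hL2 hK (half_pos hα0) (fun s hs => hγD _ (hmaps hs))
    (by
      refine LipschitzOnWith.of_dist_le_mul fun s hs t ht => ?_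
      simpa only [dist_sub_left] using hlip.dist_le_mul _ (hmaps hs) _ (hmaps ht))
    fun s hs => by
      have hsI := hmaps ⟨hs.1.le, hs.2⟩
      have := hγd _ hsI
      rw [sub_sub_cancel, min_eq_right (by linarith [hs.2])] at this
      exact hderiv _ (hγD _ hsI) s hs.1 this
  simp only [sub_half, sub_zero] at hsnd
  set T := ‖γ 0 - γ L‖ with hT
  have hT0 : 0 ≤ T := norm_nonneg _
  have hLT : (L / 2) ^ (α / 2) ≤ (2 * c) ^ (α / 2) * T ^ (α / 2) := by
    rw [← Real.mul_rpow (by positivity) hT0]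
    exact Real.rpow_le_rpow (by positivity) (by nlinarith [mul_nonneg hc.le hT0]) (by positivity)
  have hcc : (2 * c) ^ (1 - α / 2) * (2 * c) ^ (α / 2) = 2 * c := by
    rw [← Real.rpow_add (by positivity), sub_add_cancel, Real.rpow_one]
  calc ‖f (γ 0) - f (γ L)‖
      = ‖(f (γ (L / 2)) - f (γ L)) - (f (γ (L / 2)) - f (γ 0))‖ := by
        rw [sub_sub_sub_cancel_left]
    _ ≤ 2 * (K / (α / 2) * (L / 2) ^ (α / 2)) := by
        linarith [norm_sub_le (f (γ (L / 2)) - f (γ L)) (f (γ (L / 2)) - f (γ 0))]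
    _ ≤ 2 * (K / (α / 2) * ((2 * c) ^ (α / 2) * T ^ (α / 2))) := by gcongr
    _ = 4 / α * √C * ((2 * c) ^ (1 - α / 2) * (2 * c) ^ (α / 2)) * T ^ (α / 2) := by
        rw [hKdef]; field_simp; ring
    _ = 8 * c / α * √C * T ^ (α / 2) := by rw [hcc]; ring
end
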